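/- arXiv:2203.06208 — 6 statements merged into one kernel-verified Lean document; each statement's English description precedes it below -/
import Mathlib

section
/- Let ℓ be a community assignment, u ∈ V a vertex, and α a label with α ≠ ℓ(u). Let ℓ' be the assignment obtained from ℓ by moving u to community α (ℓ'(u) = α and ℓ'(w) = ℓ(w) for all w ≠ u). Then the change in modularity equals Q(ℓ') − Q(ℓ) = Σ_{w∈C_α} Q_{uw} − Σ_{w∈C_{ℓ(u)}, w≠u} Q_{uw}, where C_β := ℓ^{-1}(β) denotes the communities with respect to the original assignment ℓ. -/
open Finset

/-- Moving a vertex `u` from its community to a new community `α` changes the modularity by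
`Σ_{w ∈ C_α} Q_{uw} − Σ_{w ∈ C_{ℓ(u)}, w ≠ u} Q_{uw}`, where the communities are those of the
original assignment `ℓ`. -/
theorem modularity_change_of_move
    {V Lab : Type*} [Fintype V] [DecidableEq V] [DecidableEq Lab]
    (A : V → V → ℝ)
    (hsym : ∀ u v, A u v = A v u)
    (hnn : ∀ u v, 0 ≤ A u v)
    (hdiag : ∀ u, A u u = 0)
    (s : V → ℝ) (hs : ∀ u, s u = ∑ v, A u v)
    (W : ℝ) (hW : W = (1/2) * ∑ u, ∑ v, A u v) (hWpos : 0 < W)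
    (Qm : V → V → ℝ)
    (hQm : ∀ u v, Qm u v = (1/W) * (A u v - s u * s v / (2*W)))
    (Qmod : (V → Lab) → ℝ)
    (hQmod : ∀ ℓ : V → Lab,
      Qmod ℓ = (1/2) * ∑ u, ∑ v, Qm u v * (if ℓ u = ℓ v then (1:ℝ) else 0))
    (ℓ : V → Lab) (u : V) (α : Lab) (hα : α ≠ ℓ u)
    (ℓ' : V → Lab) (hℓ'u : ℓ' u = α) (hℓ'w : ∀ w, w ≠ u → ℓ' w = ℓ w) :
    Qmod ℓ' - Qmod ℓ
      = (∑ w ∈ univ.filter (fun w => ℓ w = α), Qm u w)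
        - (∑ w ∈ univ.filter (fun w => ℓ w = ℓ u ∧ w ≠ u), Qm u w) := by
  have hQsym : ∀ x y, Qm x y = Qm y x := by
    intro x y
    rw [hQm, hQm, hsym x y, mul_comm (s x)]
  let f : V → ℝ := fun w =>
    (if ℓ w = α then Qm u w else 0) - (if ℓ w = ℓ u ∧ w ≠ u then Qm u w else 0)
  have hf : f u = 0 := by simp [f, hα.symm]
  have key : ∀ x y, Qm x y * (if ℓ' x = ℓ' y then (1:ℝ) else 0)
      - Qm x y * (if ℓ x = ℓ y then (1:ℝ) else 0)
      = (if x = u then f y else 0) + (if y = u then f x else 0) := by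
    intro x y
    by_cases hx : x = u
    · subst hx
      by_cases hy : y = x
      · subst hy
        simp [hf]
      · simp [f, hy, Ne.symm hy, hℓ'u, hℓ'w y hy, eq_comm]
    · by_cases hy : y = u
      · subst hy
        simp [f, hx, hℓ'u, hℓ'w x hx, hQsym x y]
      · simp [hx, hy, hℓ'w x hx, hℓ'w y hy]
  have hsum : (∑ x, ∑ y, Qm x y * (if ℓ' x = ℓ' y then (1:ℝ) else 0))
      - (∑ x, ∑ y, Qm x y * (if ℓ x = ℓ y then (1:ℝ) else 0)) = 2 * ∑ w, f w := by
    simp only [← Finset.sum_sub_distrib, key]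
    simp only [Finset.sum_add_distrib]
    rw [Finset.sum_comm]
    simp [two_mul]
  rw [hQmod, hQmod, ← mul_sub, hsum, Finset.sum_filter, Finset.sum_filter,
    ← Finset.sum_sub_distrib]
  ring
end

section
/- Let ℓ be a community assignment, u ∈ V a vertex, and α a label with α ≠ ℓ(u). Let ℓ' be the assignment obtained from ℓ by moving u to community α (ℓ'(u) = α and ℓ'(w) = ℓ(w) for all w ≠ u). Then Q(ℓ') − Q(ℓ) = (S_u^α − S_u^{ℓ(u)})/W − s_u(Σ_α − Σ_{ℓ(u)} + s_u)/(2W²), where all communities are taken with respect to the original assignment ℓ. -/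
open Finset

/-- The total sum of a symmetric array supported on the row and column of `u`, with zero at the
crossing, is twice the sum over the row of `u`. -/
theorem sum_sum_eq_two_mul_sum_of_cross {V : Type*} [Fintype V] [DecidableEq V]
    (D : V → V → ℝ) (u : V) (hsymm : ∀ v w, D v w = D w v) (huu : D u u = 0)
    (hzero : ∀ v w, v ≠ u → w ≠ u → D v w = 0) :
    ∑ v, ∑ w, D v w = 2 * ∑ w, D u w := by
  have hD : ∀ v w, D v w = (if v = u then D u w else 0) + (if w = u then D u v else 0) := by
    intro v w
    by_cases hv : v = u <;> by_cases hw : w = u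
    · subst hv hw; simp [huu]
    · subst hv; simp [hw]
    · subst hw; simp [hv, hsymm]
    · simp [hv, hw, hzero v w hv hw]
  calc ∑ v, ∑ w, D v w
      = ∑ v, ∑ w, ((if v = u then D u w else 0) + (if w = u then D u v else 0)) :=
        sum_congr rfl fun v _ => sum_congr rfl fun w _ => hD v w
    _ = 2 * ∑ w, D u w := by
        simp only [sum_add_distrib]
        rw [sum_comm]
        simp [two_mul]

/-- Moving a vertex `u` from its community to a new community `α` changes the modularity by
`(S_u^α − S_u^{ℓ(u)})/W − s_u (Σ_α − Σ_{ℓ(u)} + s_u)/(2W²)`, where communities, `S_u^β` and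
`Σ_β` are with respect to the original assignment `ℓ`. -/
theorem modularity_change_formula
    {V Lab : Type*} [Fintype V] [DecidableEq V] [DecidableEq Lab]
    (A : V → V → ℝ)
    (hsym : ∀ u v, A u v = A v u)
    (hnn : ∀ u v, 0 ≤ A u v)
    (hdiag : ∀ u, A u u = 0)
    (s : V → ℝ) (hs : ∀ u, s u = ∑ v, A u v)
    (W : ℝ) (hW : W = (1/2) * ∑ u, ∑ v, A u v) (hWpos : 0 < W)
    (Qm : V → V → ℝ)
    (hQm : ∀ u v, Qm u v = (1/W) * (A u v - s u * s v / (2*W)))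
    (Qmod : (V → Lab) → ℝ)
    (hQmod : ∀ ℓ : V → Lab,
      Qmod ℓ = (1/2) * ∑ u, ∑ v, Qm u v * (if ℓ u = ℓ v then (1:ℝ) else 0))
    (ℓ : V → Lab) (u : V) (α : Lab) (hα : α ≠ ℓ u)
    (ℓ' : V → Lab) (hℓ'u : ℓ' u = α) (hℓ'w : ∀ w, w ≠ u → ℓ' w = ℓ w)
    (S : Lab → ℝ) (hS : ∀ β, S β = ∑ v ∈ univ.filter (fun v => ℓ v = β), A u v)
    (Sig : Lab → ℝ) (hSig : ∀ β, Sig β = ∑ v ∈ univ.filter (fun v => ℓ v = β), s v) :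
    Qmod ℓ' - Qmod ℓ
      = (S α - S (ℓ u)) / W - s u * (Sig α - Sig (ℓ u) + s u) / (2 * W^2) := by
  have hQsymm : ∀ v w, Qm v w = Qm w v := by
    intro v w
    rw [hQm, hQm, hsym v w, mul_comm (s v)]
  have hcross := sum_sum_eq_two_mul_sum_of_cross
    (fun v w => Qm v w * ((if ℓ' v = ℓ' w then (1:ℝ) else 0) - if ℓ v = ℓ w then 1 else 0)) u
    (fun v w => by simp only [hQsymm v w, eq_comm]) (by simp)
    (fun v w hv hw => by simp [hℓ'w v hv, hℓ'w w hw])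
  have hrow : ∀ w,
      Qm u w * ((if ℓ' u = ℓ' w then (1:ℝ) else 0) - if ℓ u = ℓ w then 1 else 0)
        = (1 / W) * ((if ℓ w = α then A u w else 0) - if ℓ w = ℓ u then A u w else 0)
          - s u / (2 * W ^ 2) * ((if ℓ w = α then s w else 0) - (if ℓ w = ℓ u then s w else 0)
            + if w = u then s u else 0) := by
    intro w
    by_cases hw : w = u
    · subst hw
      simp [hdiag, hα.symm]
    · rw [hℓ'u, hℓ'w w hw, hQm]
      simp only [hw, if_false, eq_comm (a := α), eq_comm (a := ℓ u)]
      split_ifs <;> field_simp <;> ring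
  have hdiff : Qmod ℓ' - Qmod ℓ = ∑ w,
      Qm u w * ((if ℓ' u = ℓ' w then (1:ℝ) else 0) - if ℓ u = ℓ w then 1 else 0) := by
    simp only [mul_sub, sum_sub_distrib] at hcross ⊢
    rw [hQmod, hQmod]
    linarith
  rw [hdiff, sum_congr rfl fun w _ => hrow w, sum_sub_distrib, ← mul_sum, ← mul_sum,
    sum_add_distrib, sum_sub_distrib, sum_sub_distrib, hS, hS, hSig, hSig]
  simp only [sum_filter, sum_ite_eq', mem_univ, if_true]
  ring
end

section
/- For every community assignment ℓ, the modularity satisfies −1 ≤ Q(ℓ) ≤ 1. -/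
open Finset

/-- Restricting a double sum of nonnegative terms to pairs with equal labels gives a value
between zero and the full sum. -/
theorem sum_mul_ite_label_eq_mem_Icc {V Lab : Type*} [Fintype V] [DecidableEq Lab]
    {f : V → V → ℝ} (hf : ∀ u v, 0 ≤ f u v) (ℓ : V → Lab) :
    ∑ u, ∑ v, f u v * (if ℓ u = ℓ v then (1 : ℝ) else 0) ∈ Set.Icc 0 (∑ u, ∑ v, f u v) := by
  constructor
  · refine sum_nonneg fun u _ => sum_nonneg fun v _ => mul_nonneg (hf u v) ?_
    split_ifs <;> norm_num
  · refine sum_le_sum fun u _ => sum_le_sum fun v _ => mul_le_of_le_one_right (hf u v) ?_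
    split_ifs <;> norm_num

/-- For every community assignment `ℓ`, the modularity satisfies `−1 ≤ Q(ℓ) ≤ 1`. -/
theorem modularity_bounds
    {V Lab : Type*} [Fintype V] [DecidableEq Lab]
    (A : V → V → ℝ)
    (hsym : ∀ u v, A u v = A v u)
    (hnn : ∀ u v, 0 ≤ A u v)
    (hdiag : ∀ u, A u u = 0)
    (s : V → ℝ) (hs : ∀ u, s u = ∑ v, A u v)
    (W : ℝ) (hW : W = (1/2) * ∑ u, ∑ v, A u v) (hWpos : 0 < W)
    (Qm : V → V → ℝ)
    (hQm : ∀ u v, Qm u v = (1/W) * (A u v - s u * s v / (2*W)))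
    (Qmod : (V → Lab) → ℝ)
    (hQmod : ∀ ℓ : V → Lab,
      Qmod ℓ = (1/2) * ∑ u, ∑ v, Qm u v * (if ℓ u = ℓ v then (1:ℝ) else 0))
    (ℓ : V → Lab) :
    -1 ≤ Qmod ℓ ∧ Qmod ℓ ≤ 1 := by
  have hs_nonneg : ∀ u, 0 ≤ s u := fun u => hs u ▸ sum_nonneg fun v _ => hnn u v
  have hA_sum : ∑ u, ∑ v, A u v = 2 * W := by linarith
  have hs_sum : ∑ u, s u = 2 * W := by simp only [hs, hA_sum]
  have hss_sum : ∑ u, ∑ v, s u * s v = (2 * W) * (2 * W) := by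
    rw [← sum_mul_sum, hs_sum]
  obtain ⟨hX0, hX1⟩ := sum_mul_ite_label_eq_mem_Icc hnn ℓ
  obtain ⟨hY0, hY1⟩ := sum_mul_ite_label_eq_mem_Icc
    (fun u v => mul_nonneg (hs_nonneg u) (hs_nonneg v)) ℓ
  rw [hA_sum] at hX1
  rw [hss_sum] at hY1
  have hQ : Qmod ℓ =
      (∑ u, ∑ v, A u v * (if ℓ u = ℓ v then (1 : ℝ) else 0)) / (2 * W) -
        (∑ u, ∑ v, s u * s v * (if ℓ u = ℓ v then (1 : ℝ) else 0)) / ((2 * W) * (2 * W)) := by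
    rw [hQmod]
    simp only [hQm, mul_sum, sum_div, ← sum_sub_distrib]
    refine sum_congr rfl fun u _ => sum_congr rfl fun v _ => ?_
    field_simp
  have hX0' := div_nonneg hX0 (by positivity : 0 ≤ 2 * W)
  have hX1' := div_le_one_of_le₀ hX1 (by positivity)
  have hY0' := div_nonneg hY0 (by positivity : 0 ≤ (2 * W) * (2 * W))
  have hY1' := div_le_one_of_le₀ hY1 (by positivity)
  rw [hQ]
  constructor <;> linarith
end

section
/- Suppose all edge weights A_{uv} are nonnegative integers. Let ℓ be a community assignment, u ∈ V, and α a label with α ≠ ℓ(u), and let ℓ' be the assignment obtained from ℓ by moving u to community α. If Q(ℓ') ≠ Q(ℓ), then |Q(ℓ') − Q(ℓ)| ≥ 1/(2W²). In other words, the smallest nonzero change in modularity resulting from a single vertex move is at least 1/(2W²). -/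
open Finset

/-- For a symmetric weight `F`, moving the single vertex `u` changes the total weight inside the
communities by twice the change in the weight between `u` and its community. -/
lemma sum_same_community_sub_of_move {V Lab : Type*} [Fintype V] [DecidableEq Lab]
    (F : V → V → ℝ) (hF : ∀ x y, F x y = F y x) (ℓ ℓ' : V → Lab) (u : V)
    (hmove : ∀ w, w ≠ u → ℓ' w = ℓ w) :
    (∑ x, ∑ y, F x y * (if ℓ' x = ℓ' y then (1 : ℝ) else 0)) -
        ∑ x, ∑ y, F x y * (if ℓ x = ℓ y then (1 : ℝ) else 0) =
      2 * ∑ y, F u y *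
        ((if ℓ' u = ℓ' y then (1 : ℝ) else 0) - (if ℓ u = ℓ y then (1 : ℝ) else 0)) := by
  classical
  set d : V → ℝ := fun y =>
    (if ℓ' u = ℓ' y then (1 : ℝ) else 0) - (if ℓ u = ℓ y then (1 : ℝ) else 0) with hd
  have hdu : d u = 0 := by simp [hd]
  have hpair : ∀ x y, F x y * (if ℓ' x = ℓ' y then (1 : ℝ) else 0) -
      F x y * (if ℓ x = ℓ y then (1 : ℝ) else 0) =
      (if x = u then F u y * d y else 0) + (if y = u then F u x * d x else 0) := by
    intro x y
    by_cases hx : x = u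
    · subst hx
      simp only [hdu, if_true, mul_zero, ite_self, add_zero]
      simp only [hd]
      ring
    · by_cases hy : y = u
      · subst hy
        rw [if_neg hx, if_pos rfl, hF x y]
        simp only [hd, eq_comm (a := ℓ' y), eq_comm (a := ℓ y)]
        ring
      · simp [hx, hy, hmove x hx, hmove y hy]
  simp only [← sum_sub_distrib, hpair, sum_add_distrib]
  rw [sum_comm]
  simp only [sum_ite_eq', mem_univ, if_true]
  ring

/-- If all edge weights are nonnegative integers, then the smallest nonzero change in
modularity resulting from moving a single vertex `u` to a new community `α` is at least
`1/(2W²)`. -/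
theorem modularity_min_nonzero_change
    {V Lab : Type*} [Fintype V] [DecidableEq Lab]
    (A : V → V → ℝ)
    (hsym : ∀ u v, A u v = A v u)
    (hnn : ∀ u v, 0 ≤ A u v)
    (hdiag : ∀ u, A u u = 0)
    (hint : ∀ u v, ∃ n : ℕ, A u v = (n : ℝ))
    (s : V → ℝ) (hs : ∀ u, s u = ∑ v, A u v)
    (W : ℝ) (hW : W = (1/2) * ∑ u, ∑ v, A u v) (hWpos : 0 < W)
    (Qm : V → V → ℝ)
    (hQm : ∀ u v, Qm u v = (1/W) * (A u v - s u * s v / (2*W)))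
    (Qmod : (V → Lab) → ℝ)
    (hQmod : ∀ ℓ : V → Lab,
      Qmod ℓ = (1/2) * ∑ u, ∑ v, Qm u v * (if ℓ u = ℓ v then (1:ℝ) else 0))
    (ℓ : V → Lab) (u : V) (α : Lab) (hα : α ≠ ℓ u)
    (ℓ' : V → Lab) (hℓ'u : ℓ' u = α) (hℓ'w : ∀ w, w ≠ u → ℓ' w = ℓ w)
    (hne : Qmod ℓ' ≠ Qmod ℓ) :
    |Qmod ℓ' - Qmod ℓ| ≥ 1 / (2 * W^2) := by
  choose n hn using hint
  have hQsym : ∀ x y, Qm x y = Qm y x := fun x y => by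
    rw [hQm, hQm, hsym x y, mul_comm (s x)]
  have hdiff := sum_same_community_sub_of_move Qm hQsym ℓ ℓ' u hℓ'w
  let e : V → ℤ := fun y => (if ℓ' u = ℓ' y then 1 else 0) - (if ℓ u = ℓ y then 1 else 0)
  have he : ∀ y, (if ℓ' u = ℓ' y then (1 : ℝ) else 0) - (if ℓ u = ℓ y then (1 : ℝ) else 0) =
      (e y : ℝ) := fun y => by simp [e]
  let σ : V → ℤ := fun x => ∑ y, (n x y : ℤ)
  have hσ : ∀ x, s x = (σ x : ℝ) := fun x => by simp [σ, hs, hn]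
  have hN : 2 * W = ((∑ x, σ x : ℤ) : ℝ) := by
    push_cast
    simp only [← hσ, hs, hW]
    ring
  let k : ℤ := (∑ x, σ x) * (∑ y, (n u y : ℤ) * e y) - ∑ y, σ u * σ y * e y
  have hk : (k : ℝ) = 2 * W * (∑ y, A u y * e y) - ∑ y, s u * s y * e y := by
    simp only [k, Int.cast_sub, Int.cast_mul, ← hN]
    push_cast
    simp only [hn, hσ]
  have hΔ : Qmod ℓ' - Qmod ℓ = k / (2 * W ^ 2) := by
    have hchange : Qmod ℓ' - Qmod ℓ = ∑ y, Qm u y * e y := by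
      simp only [he] at hdiff
      rw [hQmod, hQmod]
      linarith
    rw [hchange, hk, mul_sum, ← sum_sub_distrib, sum_div]
    refine sum_congr rfl fun y _ => ?_
    rw [hQm]
    field_simp
  have hk0 : k ≠ 0 := by
    intro h
    apply hne
    rw [h, Int.cast_zero, zero_div] at hΔ
    exact sub_eq_zero.mp hΔ
  have hk1 : (1 : ℝ) ≤ |(k : ℝ)| := by exact_mod_cast Int.one_le_abs hk0
  rw [hΔ, abs_div, abs_of_pos (by positivity : (0 : ℝ) < 2 * W ^ 2)]
  exact div_le_div_of_nonneg_right hk1 (by positivity)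
end

section
/- Suppose all edge weights A_{uv} are nonnegative integers. Then any finite sequence of community assignments ℓ_0, ℓ_1, …, ℓ_T with strictly increasing modularity (Q(ℓ_{k+1}) > Q(ℓ_k) for all 0 ≤ k < T) satisfies T ≤ 8W². In particular, the first phase of the Louvain algorithm, each of whose moves strictly increases modularity, terminates after at most 8W² moves, which is polynomial in the input size. -/
open Finset

/-- A sequence of integers that strictly increases over its first `T` steps gains at least `T`. -/
theorem add_le_of_forall_lt_succ {f : ℕ → ℤ} {T : ℕ} (hf : ∀ k < T, f k < f (k + 1)) :
    f 0 + T ≤ f T := by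
  induction T with
  | zero => simp
  | succ T ih =>
    have h₁ := ih fun k hk => hf k (hk.trans T.lt_succ_self)
    have h₂ := hf T T.lt_succ_self
    push_cast
    omega

/-- The integer `2W ∑ A δ - ∑ s s δ`, which is the modularity multiplied by `4W²`. -/
def scaledModularity {V Lab : Type*} [Fintype V] [DecidableEq Lab] (n : V → V → ℕ)
    (ℓ : V → Lab) : ℤ :=
  (∑ u, ∑ v, (n u v : ℤ)) * (∑ u, ∑ v, (n u v : ℤ) * (if ℓ u = ℓ v then 1 else 0)) -
    ∑ u, ∑ v, (∑ w, (n u w : ℤ)) * (∑ w, (n v w : ℤ)) * (if ℓ u = ℓ v then 1 else 0)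

/-- Restricting a double sum of nonnegative integers to the pairs with equal labels gives a value
between zero and the full sum. -/
theorem sum_mul_ite_mem_Icc {V Lab : Type*} [Fintype V] [DecidableEq Lab] {f : V → V → ℤ}
    (hf : ∀ u v, 0 ≤ f u v) (ℓ : V → Lab) :
    (∑ u, ∑ v, f u v * (if ℓ u = ℓ v then 1 else 0)) ∈ Set.Icc 0 (∑ u, ∑ v, f u v) := by
  constructor
  · refine sum_nonneg fun u _ => sum_nonneg fun v _ => ?_
    split_ifs <;> simp [hf u v]
  · refine sum_le_sum fun u _ => sum_le_sum fun v _ => ?_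
    split_ifs <;> simp [hf u v]

theorem abs_scaledModularity_le {V Lab : Type*} [Fintype V] [DecidableEq Lab] (n : V → V → ℕ)
    (ℓ : V → Lab) : |scaledModularity n ℓ| ≤ (∑ u, ∑ v, (n u v : ℤ)) ^ 2 := by
  obtain ⟨ha₀, ha⟩ := sum_mul_ite_mem_Icc (f := fun u v => (n u v : ℤ)) (fun u v => by positivity) ℓ
  obtain ⟨hb₀, hb⟩ := sum_mul_ite_mem_Icc
    (f := fun u v => (∑ w, (n u w : ℤ)) * ∑ w, (n v w : ℤ)) (fun u v => by positivity) ℓ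
  rw [← Finset.sum_mul_sum] at hb
  have hm : (0 : ℤ) ≤ ∑ u, ∑ v, (n u v : ℤ) := by positivity
  have hma := mul_le_mul_of_nonneg_left ha hm
  have hma₀ := mul_nonneg hm ha₀
  rw [abs_le, scaledModularity]
  constructor <;> linarith

/-- If all edge weights are nonnegative integers, then any finite sequence of community
assignments with strictly increasing modularity has length at most `8W²`. -/
theorem modularity_increasing_sequence_length
    {V Lab : Type*} [Fintype V] [DecidableEq Lab]
    (A : V → V → ℝ)
    (hsym : ∀ u v, A u v = A v u)
    (hnn : ∀ u v, 0 ≤ A u v)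
    (hdiag : ∀ u, A u u = 0)
    (hint : ∀ u v, ∃ n : ℕ, A u v = (n : ℝ))
    (s : V → ℝ) (hs : ∀ u, s u = ∑ v, A u v)
    (W : ℝ) (hW : W = (1/2) * ∑ u, ∑ v, A u v) (hWpos : 0 < W)
    (Qm : V → V → ℝ)
    (hQm : ∀ u v, Qm u v = (1/W) * (A u v - s u * s v / (2*W)))
    (Qmod : (V → Lab) → ℝ)
    (hQmod : ∀ ℓ : V → Lab,
      Qmod ℓ = (1/2) * ∑ u, ∑ v, Qm u v * (if ℓ u = ℓ v then (1:ℝ) else 0))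
    (ℓseq : ℕ → V → Lab) (T : ℕ)
    (hmono : ∀ k, k < T → Qmod (ℓseq k) < Qmod (ℓseq (k+1))) :
    (T : ℝ) ≤ 8 * W^2 := by
  choose n hn using hint
  obtain rfl : A = fun u v => (n u v : ℝ) := by ext u v; exact hn u v
  have h2W : ((∑ u, ∑ v, (n u v : ℤ) : ℤ) : ℝ) = 2 * W := by
    push_cast
    linarith
  have hscale (ℓ : V → Lab) : (scaledModularity n ℓ : ℝ) = 4 * W ^ 2 * Qmod ℓ := by
    rw [scaledModularity, Int.cast_sub, Int.cast_mul, h2W, hQmod]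
    push_cast
    simp only [mul_sum, ← sum_sub_distrib, hQm, ← hs]
    refine sum_congr rfl fun u _ => sum_congr rfl fun v _ => ?_
    field_simp
    ring
  have hgain := add_le_of_forall_lt_succ (f := fun k => scaledModularity n (ℓseq k)) (T := T)
    fun k hk => by
      have h := mul_lt_mul_of_pos_left (hmono k hk) (show 0 < 4 * W ^ 2 by positivity)
      rw [← hscale, ← hscale] at h
      exact_mod_cast h
  have h₀ := (abs_le.1 (abs_scaledModularity_le n (ℓseq 0))).1
  have h₁ := (abs_le.1 (abs_scaledModularity_le n (ℓseq T))).2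
  have hT : (T : ℤ) ≤ 2 * (∑ u, ∑ v, (n u v : ℤ)) ^ 2 := by linarith
  have hT' : ((T : ℤ) : ℝ) ≤ ((2 * (∑ u, ∑ v, (n u v : ℤ)) ^ 2 : ℤ) : ℝ) := Int.cast_le.2 hT
  rw [Int.cast_mul, Int.cast_pow, h2W, Int.cast_natCast] at hT'
  push_cast at hT'
  linarith
end

section
/- Let L and t be positive integers with 1 ≤ t < L/4, and define F(L,t) := (9/4) · L/√((L−t)t) + ⌈log_{6/5}( L / (2√((L−t)t)) )⌉ − 3. Then F(L,t) ≤ (α/3) · √L/√t, where α = 9.2. -/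
theorem log_six_fifths_lower : (2 / 11 : ℝ) ≤ Real.log (6/5) := by
  have h := Real.sum_range_le_log_div (x := 1/11) (by norm_num) (by norm_num) 1
  norm_num at h
  linarith

theorem log_six_fifths_upper : Real.log (6/5) ≤ (100 / 547 : ℝ) := by
  have h := Real.log_div_le_sum_range_add (x := 1/11) (by norm_num) (by norm_num) 2
  norm_num at h
  linarith

/-- A linear upper bound for the logarithm to base `6/5`, from concavity at `2 * (6/5) ^ k`. -/
theorem logb_six_fifths_half_le (k : ℕ) {g : ℝ} (hg : 0 < g) :
    Real.logb (6/5) (g / 2) ≤ k + 5.5 * (g / (2 * (6/5) ^ k)) - 5.47 := by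
  have hl := log_six_fifths_lower
  have hu := log_six_fifths_upper
  have hlog : 0 < Real.log (6/5) := by linarith
  have hy : 0 < g / (2 * (6/5) ^ k) := by positivity
  set y := g / (2 * (6/5) ^ k) with hyd
  have hgy : g / 2 = (6/5) ^ k * y := by rw [hyd]; field_simp
  have h1 := Real.log_le_sub_one_of_pos hy
  rw [hgy, Real.logb, Real.log_mul (by positivity) hy.ne', Real.log_pow, div_le_iff₀ hlog]
  nlinarith [mul_le_mul_of_nonneg_left hl hy.le]

theorem linear_bound_of_sq_mul_eq {g s a b : ℝ} (hb : 0 ≤ b) (hs : 2 < s)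
    (h : g ^ 2 * (s ^ 2 - 1) = s ^ 4)
    (hp : a ^ 2 * s ^ 4 ≤ (9.2 / 3 * s + b) ^ 2 * (s ^ 2 - 1)) :
    a * g ≤ 9.2 / 3 * s + b := by
  have hs1 : 0 < s ^ 2 - 1 := by nlinarith
  refine le_of_sq_le_sq ?_ (by positivity)
  refine le_of_mul_le_mul_right ?_ hs1
  calc (a * g) ^ 2 * (s ^ 2 - 1) = a ^ 2 * s ^ 4 := by rw [← h]; ring
    _ ≤ _ := hp

theorem grover_real_bound {g s : ℝ} (hg : 0 < g) (hs : 2 < s)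
    (h : g ^ 2 * (s ^ 2 - 1) = s ^ 4) :
    9 / 4 * g + Real.logb (6/5) (g / 2) - 2 ≤ 9.2 / 3 * s := by
  rcases le_total s 4 with h4 | h4
  · have hlog := logb_six_fifths_half_le 6 hg
    have hlin := linear_bound_of_sq_mul_eq (a := 3.171) (b := 1.47) (by norm_num)
      hs h (by
        obtain ⟨d, rfl⟩ : ∃ d, s = 2 + d := ⟨s - 2, by ring⟩
        have hd : 0 ≤ d := by linarith
        have hd2 : 0 ≤ 2 - d := by linarith
        nlinarith [pow_nonneg hd 2, pow_nonneg hd 3, mul_nonneg (pow_nonneg hd 3) hd2])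
    norm_num at hlog hlin ⊢
    linarith
  · have hlog := logb_six_fifths_half_le 7 hg
    have hlin := linear_bound_of_sq_mul_eq (a := 3.018) (b := 0.47) (by norm_num)
      hs h (by
        obtain ⟨d, rfl⟩ : ∃ d, s = 4 + d := ⟨s - 4, by ring⟩
        have hd : 0 ≤ d := by linarith
        nlinarith [pow_nonneg hd 2, pow_nonneg hd 3, pow_nonneg hd 4])
    norm_num at hlog hlin ⊢
    linarith


/-- For positive integers `L, t` with `1 ≤ t < L/4`, the Grover-iteration bound
`F(L,t) = (9/4)·L/√((L−t)t) + ⌈log_{6/5}(L/(2√((L−t)t)))⌉ − 3` satisfies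
`F(L,t) ≤ (α/3)·√L/√t` with `α = 9.2`. -/
theorem grover_iteration_bound (L t : ℕ) (ht : 1 ≤ t) (htL : (t : ℝ) < (L : ℝ) / 4) :
    (9/4) * (L : ℝ) / Real.sqrt (((L : ℝ) - (t : ℝ)) * (t : ℝ))
      + ((⌈Real.logb (6/5) ((L : ℝ) / (2 * Real.sqrt (((L : ℝ) - (t : ℝ)) * (t : ℝ))))⌉ : ℤ) : ℝ)
      - 3
    ≤ (9.2 / 3) * Real.sqrt (L : ℝ) / Real.sqrt (t : ℝ) := by
  have ht0 : (0 : ℝ) < t := by exact_mod_cast ht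
  have hL0 : (0 : ℝ) < L := by linarith
  have hLt : (0 : ℝ) < (L : ℝ) - t := by linarith
  have hD : 0 < Real.sqrt (((L : ℝ) - t) * t) := Real.sqrt_pos.2 (mul_pos hLt ht0)
  have hs : 2 < Real.sqrt L / Real.sqrt t := by
    rw [← Real.sqrt_div hL0.le, Real.lt_sqrt (by norm_num), lt_div_iff₀ ht0]
    linarith
  have hrel : ((L : ℝ) / Real.sqrt (((L : ℝ) - t) * t)) ^ 2
      * ((Real.sqrt L / Real.sqrt t) ^ 2 - 1) = (Real.sqrt L / Real.sqrt t) ^ 4 := by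
    rw [show (Real.sqrt L / Real.sqrt t) ^ 4 = ((Real.sqrt L / Real.sqrt t) ^ 2) ^ 2 by ring,
      div_pow, div_pow, Real.sq_sqrt (mul_pos hLt ht0).le, Real.sq_sqrt hL0.le,
      Real.sq_sqrt ht0.le]
    field_simp
  have hmain := grover_real_bound (div_pos hL0 hD) hs hrel
  have hceil := Int.ceil_lt_add_one
    (Real.logb (6/5) ((L : ℝ) / (2 * Real.sqrt (((L : ℝ) - t) * t))))
  have hdiv : (L : ℝ) / (2 * Real.sqrt (((L : ℝ) - t) * t))
      = L / Real.sqrt (((L : ℝ) - t) * t) / 2 := by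
    rw [div_div, mul_comm]
  rw [hdiv] at hceil ⊢
  rw [mul_div_assoc, mul_div_assoc]
  linarith
end
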